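/- Let w be a weight on ℝ with finite dyadic A₂ constant [w]_{A₂}, σ := 1/w, and m, n ≥ 0 integers. Suppose that for each dyadic interval J we are given h_J^σ supported on J, constant on each half of J, with ∫ h_J^σ σ dx = 0 and ∫ (h_J^σ)² σ dx = 1. For a dyadic interval L define R_L(φw) := ∑_{I ⊆ L, |I| = 2^{−m}|L|} ⟨|φ|w⟩_I (Δ_I w/⟨w⟩_I)(|I|/√|L|) and S_L(ψσ) := ∑_{J ⊆ L, |J| = 2^{−n}|L|} |∫ ψ h_J^σ σ dx| √⟨σ⟩_J √(|J|/|L|). Then there is an absolute constant C such that for all φ ∈ L²(w dx), ψ ∈ L²(σ dx): ∑_{L dyadic} R_L(φw) S_L(ψσ) ≤ C (m+n+1)³ [w]_{A₂} ‖φ‖_{L²(w)} ‖ψ‖_{L²(σ)}. -/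

import Mathlib

open MeasureTheory Set
open scoped ENNReal Classical

noncomputable section

/-- Length of a dyadic interval of generation `j`. -/
def dlen (j : ℤ) : ℝ := (2 : ℝ) ^ (-j)

/-- The dyadic interval `I_{j,k} = [k·2^{-j}, (k+1)·2^{-j})`. -/
def dyad (j k : ℤ) : Set ℝ := Set.Ico ((k : ℝ) * dlen j) (((k : ℝ) + 1) * dlen j)

/-- Average `⟨f⟩_I` of `f` over the dyadic interval `I = I_{j,k}`. -/
def avg (f : ℝ → ℝ) (j k : ℤ) : ℝ := (dlen j)⁻¹ * ∫ x in dyad j k, f x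

/-- The Haar function `h_I` of the dyadic interval `I = I_{j,k}`. -/
def haar (j k : ℤ) : ℝ → ℝ := fun x =>
  (Real.sqrt (dlen j))⁻¹ *
    ((dyad (j + 1) (2 * k + 1)).indicator (fun _ => (1 : ℝ)) x -
      (dyad (j + 1) (2 * k)).indicator (fun _ => (1 : ℝ)) x)

/-- `Δ_I w` for `I = I_{j,k}`. -/
def dOsc (w : ℝ → ℝ) (j k : ℤ) : ℝ :=
  |avg w (j + 1) (2 * k) - avg w j k| + |avg w (j + 1) (2 * k + 1) - avg w j k|

/-- `R_L(φv) = ∑_{I ⊆ L, |I| = 2^{-m}|L|} ⟨|φ|v⟩_I (Δ_I v/⟨v⟩_I)(|I|/√|L|)`. -/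
def RL (v : ℝ → ℝ) (m : ℕ) (φ : ℝ → ℝ) (j k : ℤ) : ℝ :=
  ∑ ki ∈ Finset.Ico ((2 : ℤ) ^ m * k) ((2 : ℤ) ^ m * (k + 1)),
    avg (fun x => |φ x| * v x) (j + m) ki * (dOsc v (j + m) ki / avg v (j + m) ki) *
      (dlen (j + m) / Real.sqrt (dlen j))

/-- `S_L(ψv) = ∑_{J ⊆ L, |J| = 2^{-n}|L|} |(ψv, h_J^v)| √⟨v⟩_J √(|J|/|L|)`. -/
def SL (v : ℝ → ℝ) (hV : ℤ → ℤ → ℝ → ℝ) (n : ℕ) (ψ : ℝ → ℝ) (j k : ℤ) : ℝ :=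
  ∑ kj ∈ Finset.Ico ((2 : ℤ) ^ n * k) ((2 : ℤ) ^ n * (k + 1)),
    |∫ x, ψ x * hV (j + n) kj x * v x| * Real.sqrt (avg v (j + n) kj) *
      Real.sqrt (dlen (j + n) / dlen j)

lemma ent_lower (ρ : ℝ) (h1 : -1 < ρ) (h2 : ρ < 1) :
    ρ ^ 2 / 2 ≤ (1 + ρ) * Real.log (1 + ρ) + (1 - ρ) * Real.log (1 - ρ) := by
  have key : ∀ x : ℝ, 0 < x → 2 * (x - √x) ≤ x * Real.log x := by
    intro x hx
    have hs : 0 < √x := Real.sqrt_pos.2 hx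
    have hxx : √x * √x = x := Real.mul_self_sqrt hx.le
    have h := Real.one_sub_inv_le_log_of_pos hs
    have hl : Real.log x = 2 * Real.log (√x) := by
      rw [Real.log_sqrt hx.le]; ring
    rw [hl]
    have : x * (√x)⁻¹ = √x := by
      field_simp; nlinarith
    nlinarith
  have ha := key (1 + ρ) (by linarith)
  have hb := key (1 - ρ) (by linarith)
  have hs : √(1 + ρ) + √(1 - ρ) ≤ 2 - ρ ^ 2 / 4 := by
    have p1 : √(1 + ρ) ^ 2 = 1 + ρ := Real.sq_sqrt (by linarith)
    have p2 : √(1 - ρ) ^ 2 = 1 - ρ := Real.sq_sqrt (by linarith)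
    have q1 := Real.sqrt_nonneg (1 + ρ)
    have q2 := Real.sqrt_nonneg (1 - ρ)
    have h3 : √(1 + ρ) * √(1 - ρ) ≤ 1 - ρ ^ 2 / 2 := by
      apply abs_le_of_sq_le_sq' _ (by nlinarith) |>.2
      rw [mul_pow, p1, p2]; nlinarith [sq_nonneg (ρ^2)]
    apply abs_le_of_sq_le_sq' _ (by nlinarith) |>.2
    nlinarith [sq_nonneg (ρ^2)]
  linarith

lemma atanh_bound (r : ℝ) (h1 : -1 < r) (h2 : r < 1) :
    ((Real.log (1 + r) - Real.log (1 - r)) / 2) ^ 2 ≤ r ^ 2 / (1 - r ^ 2) := by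
  set θ := (Real.log (1 + r) - Real.log (1 - r)) / 2 with hθ
  have hp : 0 < 1 + r := by linarith
  have hm : 0 < 1 - r := by linarith
  have hsq : θ ^ 2 ≤ Real.sinh θ ^ 2 := by
    rw [sq_le_sq]
    rcases le_total 0 θ with h | h
    · rw [abs_of_nonneg h, abs_of_nonneg (Real.sinh_nonneg_iff.2 h)]
      exact Real.self_le_sinh_iff.2 h
    · rw [abs_of_nonpos h, abs_of_nonpos (Real.sinh_nonpos_iff.2 h)]
      linarith [Real.sinh_le_self_iff.2 h]
  have he : Real.sinh θ ^ 2 = r ^ 2 / (1 - r ^ 2) := by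
    have hc : Real.cosh (2 * θ) = ((1 + r) / (1 - r) + (1 - r) / (1 + r)) / 2 := by
      rw [Real.cosh_eq]
      have e1 : 2 * θ = Real.log (1 + r) - Real.log (1 - r) := by rw [hθ]; ring
      have e2 : -(2 * θ) = Real.log (1 - r) - Real.log (1 + r) := by rw [hθ]; ring
      rw [e2, e1, Real.exp_sub, Real.exp_sub, Real.exp_log hp, Real.exp_log hm]
    have h4 : Real.cosh (2 * θ) = 1 + 2 * Real.sinh θ ^ 2 := by
      rw [Real.cosh_two_mul, Real.cosh_sq]; ring
    have h5 : Real.sinh θ ^ 2 = (((1 + r) / (1 - r) + (1 - r) / (1 + r)) / 2 - 1) / 2 := by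
      linarith
    rw [h5]
    have : (1 - r ^ 2) ≠ 0 := by nlinarith
    field_simp
    ring
  linarith

/-- Bellman function for the packing condition. -/
noncomputable def bellB (Q u v : ℝ) : ℝ := 3 * Q * (u - v⁻¹) - u * (Real.log u + Real.log v)

lemma bellB_step (Q u1 u2 v1 v2 u v : ℝ) (hu1 : 0 < u1) (hu2 : 0 < u2) (hv1 : 0 < v1)
    (hv2 : 0 < v2) (hu : u = (u1 + u2) / 2) (hv : v = (v1 + v2) / 2) (hQ : u * v ≤ Q) :
    (bellB Q u1 v1 + bellB Q u2 v2) / 2 + (u2 - u1) ^ 2 / (32 * u) ≤ bellB Q u v := by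
  have hu0 : 0 < u := by rw [hu]; positivity
  have hv0 : 0 < v := by rw [hv]; positivity
  obtain ⟨ρ, hρ⟩ : ∃ ρ, u2 = u * (1 + ρ) := ⟨u2 / u - 1, by field_simp; ring⟩
  obtain ⟨r, hr⟩ : ∃ r, v2 = v * (1 + r) := ⟨v2 / v - 1, by field_simp; ring⟩
  have hρ1 : u1 = u * (1 - ρ) := by linarith
  have hr1 : v1 = v * (1 - r) := by linarith
  have a1 : 0 < 1 + ρ := by rw [hρ] at hu2; exact pos_of_mul_pos_right hu2 hu0.le
  have a2 : 0 < 1 - ρ := by rw [hρ1] at hu1; exact pos_of_mul_pos_right hu1 hu0.le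
  have a3 : 0 < 1 + r := by rw [hr] at hv2; exact pos_of_mul_pos_right hv2 hv0.le
  have a4 : 0 < 1 - r := by rw [hr1] at hv1; exact pos_of_mul_pos_right hv1 hv0.le
  have a5 : 0 < 1 - r ^ 2 := by nlinarith
  have E := ent_lower ρ (by linarith) (by linarith)
  have T := atanh_bound r (by linarith) (by linarith)
  have L : Real.log (1 + r) + Real.log (1 - r) ≥ - (r ^ 2 / (1 - r ^ 2)) := by
    rw [← Real.log_mul a3.ne' a4.ne']
    have := Real.one_sub_inv_le_log_of_pos (mul_pos a3 a4)
    have e : 1 - ((1 + r) * (1 - r))⁻¹ = - (r ^ 2 / (1 - r ^ 2)) := by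
      have : (1 + r) * (1 - r) = 1 - r ^ 2 := by ring
      rw [this]; field_simp; ring
    linarith
  set X := r ^ 2 / (1 - r ^ 2) with hX
  have hX0 : 0 ≤ X := by positivity
  have hinv : (v1⁻¹ + v2⁻¹) / 2 = v⁻¹ + X * v⁻¹ := by
    rw [hr, hr1, hX]; 
    have : 1 - r ^ 2 = (1 + r) * (1 - r) := by ring
    rw [this]
    field_simp; ring
  have hQv : u ≤ Q * v⁻¹ := by
    rw [← div_eq_mul_inv, le_div_iff₀ hv0]; exact hQ
  have hl1 : Real.log u1 = Real.log u + Real.log (1 - ρ) := by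
    rw [hρ1, Real.log_mul hu0.ne' a2.ne']
  have hl2 : Real.log u2 = Real.log u + Real.log (1 + ρ) := by
    rw [hρ, Real.log_mul hu0.ne' a1.ne']
  have hl3 : Real.log v1 = Real.log v + Real.log (1 - r) := by
    rw [hr1, Real.log_mul hv0.ne' a4.ne']
  have hl4 : Real.log v2 = Real.log v + Real.log (1 + r) := by
    rw [hr, Real.log_mul hv0.ne' a3.ne']
  have hd : (u2 - u1) ^ 2 / (32 * u) = u * (ρ ^ 2 / 8) := by
    rw [hρ, hρ1]; field_simp; ring
  rw [hd]
  unfold bellB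
  rw [hl1, hl2, hl3, hl4]
  generalize Real.log (1 + r) = lp at *
  generalize Real.log (1 - r) = lm at *
  generalize Real.log (1 + ρ) = mp at *
  generalize Real.log (1 - ρ) = mm at *
  generalize Real.log u = lu at *
  generalize Real.log v = lv at *
  have key : 0 ≤ u * (((1 + ρ) * mp + (1 - ρ) * mm) / 2 + (lp + lm) / 2 + ρ * ((lp - lm) / 2)
      + 3 * X - ρ ^ 2 / 8) := by
    apply mul_nonneg hu0.le
    nlinarith [sq_nonneg (ρ + 4 * ((lp - lm) / 2))]
  have k2 : u * X ≤ Q * v⁻¹ * X := mul_le_mul_of_nonneg_right hQv hX0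
  have e1 : v1⁻¹ = 2 * (v⁻¹ + X * v⁻¹) - v2⁻¹ := by linarith
  rw [e1, hρ, hρ1]
  nlinarith

lemma bellB_nonneg (Q u v : ℝ) (hu : 0 < u) (hv : 0 < v) (h1 : 1 ≤ u * v) (hQ : u * v ≤ Q) :
    0 ≤ bellB Q u v := by
  unfold bellB
  rw [← Real.log_mul hu.ne' hv.ne']
  have h := Real.log_le_sub_one_of_pos (mul_pos hu hv)
  have h2 : u * Real.log (u * v) ≤ u * (u * v - 1) := mul_le_mul_of_nonneg_left h hu.le
  have h3 : u - v⁻¹ = (u * v - 1) * v⁻¹ := by field_simp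
  have h4 : u * (u * v - 1) ≤ Q * (u - v⁻¹) := by
    rw [h3]
    have : u ≤ Q * v⁻¹ := by rw [← div_eq_mul_inv, le_div_iff₀ hv]; exact hQ
    nlinarith [mul_le_mul_of_nonneg_right this (by linarith : 0 ≤ u * v - 1)]
  have h5 : 0 ≤ Q * (u - v⁻¹) := le_trans (mul_nonneg hu.le (by linarith)) h4
  nlinarith

lemma bellB_le (Q u v : ℝ) (hu : 0 < u) (hv : 0 < v) (h1 : 1 ≤ u * v) (hQ : u * v ≤ Q) :
    bellB Q u v ≤ 3 * Q * u := by
  unfold bellB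
  rw [← Real.log_mul hu.ne' hv.ne']
  have h := Real.log_nonneg h1
  have : 0 ≤ u * Real.log (u * v) := mul_nonneg hu.le h
  have : 0 ≤ Q * v⁻¹ := mul_nonneg (by linarith) (by positivity)
  nlinarith

lemma frac_convex (f1 f2 x1 x2 : ℝ) (h1 : 0 < x1) (h2 : 0 < x2) :
    (f1 + f2) ^ 2 / (x1 + x2) ≤ f1 ^ 2 / x1 + f2 ^ 2 / x2 := by
  rw [div_add_div _ _ h1.ne' h2.ne', div_le_div_iff₀ (by positivity) (by positivity)]
  nlinarith [mul_nonneg (mul_pos h1 h2).le (sq_nonneg (f1 * x2 - f2 * x1)),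
    sq_nonneg (f1 * x2 - f2 * x1)]

lemma embed_step (f1 f2 x1 x2 f x u α : ℝ) (h1 : 0 < x1) (h2 : 0 < x2) (hf : f = (f1 + f2) / 2)
    (hα : 0 ≤ α) (hx : (x1 + x2) / 2 + α ≤ x) (hu : 0 < u) (hxu : x ≤ 2 * u) :
    f ^ 2 / x + α * f ^ 2 / (4 * u ^ 2) ≤ (f1 ^ 2 / x1 + f2 ^ 2 / x2) / 2 := by
  have c := frac_convex f1 f2 x1 x2 h1 h2
  have hy : 0 < (x1 + x2) / 2 := by positivity
  have hx0 : 0 < x := by linarith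
  have e : (f1 + f2) ^ 2 / (x1 + x2) = 2 * (f ^ 2 / ((x1 + x2) / 2)) := by
    rw [hf]; field_simp
  rw [e] at c
  set y := (x1 + x2) / 2
  have h3 : f ^ 2 / x + α * f ^ 2 / (4 * u ^ 2) ≤ f ^ 2 / y := by
    have s1 : α * f ^ 2 / (4 * u ^ 2) ≤ α * f ^ 2 / (x * y) := by
      apply div_le_div_of_nonneg_left (by positivity) (by positivity)
      nlinarith
    have s2 : f ^ 2 / x + α * f ^ 2 / (x * y) = f ^ 2 * (y + α) / (x * y) := by
      field_simp
    have s3 : f ^ 2 * (y + α) / (x * y) ≤ f ^ 2 * x / (x * y) := by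
      gcongr
    have s4 : f ^ 2 * x / (x * y) = f ^ 2 / y := by field_simp
    linarith
  linarith

lemma haar_step (a b s t p q : ℝ) (hs : 0 < s) (ht : 0 < t) (h0 : a * s + b * t = 0)
    (h1 : a ^ 2 * s + b ^ 2 * t = 1) :
    (p + q) ^ 2 / (s + t) + (a * p + b * q) ^ 2 = p ^ 2 / s + q ^ 2 / t := by
  have hb : b = - a * s / t := by field_simp; linarith
  have ha : a ^ 2 = t / (s * (s + t)) := by
    rw [hb] at h1
    field_simp at h1 ⊢
    nlinarith
  have : (a * p + b * q) ^ 2 = a ^ 2 * (p - q * s / t) ^ 2 := by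
    rw [hb]; field_simp; ring
  rw [this, ha]
  field_simp
  ring

lemma dlen_pos (j : ℤ) : 0 < dlen j := by unfold dlen; positivity

lemma dlen_succ (j : ℤ) : dlen j = 2 * dlen (j + 1) := by
  unfold dlen
  rw [neg_add, zpow_add₀ two_ne_zero]; norm_num; ring

lemma mem_dyad (j k : ℤ) (x : ℝ) : x ∈ dyad j k ↔ ⌊x / dlen j⌋ = k := by
  unfold dyad
  rw [Int.floor_eq_iff, le_div_iff₀ (dlen_pos j), div_lt_iff₀ (dlen_pos j)]
  rfl

lemma meas_dyad (j k : ℤ) : MeasurableSet (dyad j k) := measurableSet_Ico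

lemma disj_dyad (j : ℤ) : Pairwise (Function.onFun Disjoint (dyad j)) := by
  intro a b hab
  rw [Function.onFun, Set.disjoint_left]
  intro x hx hy
  rw [mem_dyad] at hx hy
  exact hab (hx.symm.trans hy)

lemma dyad_split (j k : ℤ) : dyad j k = dyad (j + 1) (2 * k) ∪ dyad (j + 1) (2 * k + 1) := by
  unfold dyad
  rw [dlen_succ j]
  have := dlen_pos (j + 1)
  push_cast
  have e1 : (k : ℝ) * (2 * dlen (j + 1)) = 2 * k * dlen (j + 1) := by ring
  have e2 : ((k : ℝ) + 1) * (2 * dlen (j + 1)) = (2 * k + 1 + 1) * dlen (j + 1) := by ring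
  rw [e1, e2, Set.Ico_union_Ico_eq_Ico] <;> nlinarith

lemma disj_halves (j k : ℤ) : Disjoint (dyad (j + 1) (2 * k)) (dyad (j + 1) (2 * k + 1)) :=
  disj_dyad (j + 1) (by omega)

lemma li_on {f : ℝ → ℝ} (hf : LocallyIntegrable f) (j k : ℤ) : IntegrableOn f (dyad j k) :=
  (hf.integrableOn_isCompact isCompact_Icc).mono_set Set.Ico_subset_Icc_self

lemma int_split {f : ℝ → ℝ} (hf : LocallyIntegrable f) (j k : ℤ) :
    ∫ x in dyad j k, f x = (∫ x in dyad (j + 1) (2 * k), f x) +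
      ∫ x in dyad (j + 1) (2 * k + 1), f x := by
  rw [dyad_split j k]
  exact setIntegral_union (disj_halves j k) (meas_dyad _ _) (li_on hf _ _) (li_on hf _ _)

lemma dlen_avg (f : ℝ → ℝ) (j k : ℤ) : dlen j * avg f j k = ∫ x in dyad j k, f x := by
  unfold avg
  rw [mul_inv_cancel_left₀ (dlen_pos j).ne']

lemma avg_split {f : ℝ → ℝ} (hf : LocallyIntegrable f) (j k : ℤ) :
    avg f j k = (avg f (j + 1) (2 * k) + avg f (j + 1) (2 * k + 1)) / 2 := by
  unfold avg
  rw [int_split hf, dlen_succ j]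
  have := dlen_pos (j + 1)
  field_simp

lemma vol_dyad_pos (j k : ℤ) : 0 < volume (dyad j k) := by
  unfold dyad
  rw [Real.volume_Ico, ENNReal.ofReal_pos]
  nlinarith [dlen_pos j]

lemma int_pos {f : ℝ → ℝ} (hf : LocallyIntegrable f) (h0 : ∀ x, 0 < f x) (j k : ℤ) :
    0 < ∫ x in dyad j k, f x := by
  rw [setIntegral_pos_iff_support_of_nonneg_ae]
  · have : Function.support f = univ := by
      ext x; simp [(h0 x).ne']
    rw [this, univ_inter]
    exact vol_dyad_pos j k
  · exact Filter.Eventually.of_forall fun x => (h0 x).le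
  · exact li_on hf j k

lemma avg_pos {f : ℝ → ℝ} (hf : LocallyIntegrable f) (h0 : ∀ x, 0 < f x) (j k : ℤ) :
    0 < avg f j k :=
  mul_pos (inv_pos.2 (dlen_pos j)) (int_pos hf h0 j k)

/-- Cauchy-Schwarz on a set through the quadratic trick. -/
lemma cs_set (s : Set ℝ) (a b c : ℝ → ℝ) (ha : IntegrableOn a s) (hb : IntegrableOn b s)
    (hc : IntegrableOn c s) (h : ∀ t x : ℝ, 0 ≤ a x + 2 * t * b x + t ^ 2 * c x)
    (hpos : 0 < ∫ x in s, c x) :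
    (∫ x in s, b x) ^ 2 ≤ (∫ x in s, a x) * ∫ x in s, c x := by
  set A := ∫ x in s, a x
  set B := ∫ x in s, b x
  set D := ∫ x in s, c x
  have key : 0 ≤ A + 2 * (-B / D) * B + (-B / D) ^ 2 * D := by
    have h1 : 0 ≤ ∫ x in s, (a x + 2 * (-B / D) * b x + (-B / D) ^ 2 * c x) :=
      integral_nonneg fun x => h _ x
    have hb2 : IntegrableOn (fun x => 2 * (-B / D) * b x) s := hb.const_mul _
    have hc2 : IntegrableOn (fun x => (-B / D) ^ 2 * c x) s := hc.const_mul _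
    have hab : IntegrableOn (fun x => a x + 2 * (-B / D) * b x) s := ha.add hb2
    rw [integral_add hab hc2, integral_add ha hb2, integral_const_mul, integral_const_mul] at h1
    exact h1
  have e : A + 2 * (-B / D) * B + (-B / D) ^ 2 * D = (A * D - B ^ 2) / D := by
    field_simp; ring
  rw [e] at key
  have := (div_nonneg_iff.1 key)
  rcases this with h | h
  · linarith [h.1]
  · linarith [h.2]

lemma tsum_parity (h : ℤ → ℝ≥0∞) : ∑' k, (h (2 * k) + h (2 * k + 1)) = ∑' k, h k := by
  rw [ENNReal.tsum_add]
  symm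
  have i1 : Function.Injective (fun k : ℤ => 2 * k) := fun a b hab => by
    simp only at hab; omega
  have i2 : Function.Injective (fun k : ℤ => 2 * k + 1) := fun a b hab => by
    simp only at hab; omega
  have hc : IsCompl (Set.range (fun k : ℤ => 2 * k)) (Set.range (fun k : ℤ => 2 * k + 1)) := by
    refine isCompl_iff.2 ⟨?_, codisjoint_iff.2 ?_⟩
    · rw [Set.disjoint_left]
      rintro x ⟨a, rfl⟩ ⟨b, hb⟩
      simp only at hb; omega
    · ext x
      simp only [Set.sup_eq_union, Set.top_eq_univ, Set.mem_union, Set.mem_range, Set.mem_univ, iff_true]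
      rcases Int.even_or_odd' x with ⟨c, h | h⟩
      · exact Or.inl ⟨c, h.symm⟩
      · exact Or.inr ⟨c, h.symm⟩
  have a1 := i1.hasSum_range_iff.2
    (ENNReal.summable (f := fun k : ℤ => h (2 * k))).hasSum
  have a2 := i2.hasSum_range_iff.2
    (ENNReal.summable (f := fun k : ℤ => h (2 * k + 1))).hasSum
  exact (HasSum.add_isCompl hc (f := h) a1 a2).tsum_eq

/-- Sum over the `m`-th generation descendants. -/
def dsum {α : Type*} [AddCommMonoid α] (m : ℕ) (h : ℤ → α) (k : ℤ) : α :=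
  ∑ ki ∈ Finset.Ico ((2 : ℤ) ^ m * k) ((2 : ℤ) ^ m * (k + 1)), h ki

lemma dsum_succ {α : Type*} [AddCommMonoid α] (m : ℕ) (h : ℤ → α) (k : ℤ) :
    dsum (m + 1) h k = dsum m h (2 * k) + dsum m h (2 * k + 1) := by
  unfold dsum
  have hp : (0 : ℤ) < 2 ^ m := by positivity
  have e1 : (2 : ℤ) ^ (m + 1) * k = 2 ^ m * (2 * k) := by ring
  have e2 : (2 : ℤ) ^ (m + 1) * (k + 1) = 2 ^ m * (2 * k + 1 + 1) := by ring
  rw [e1, e2, ← Finset.sum_union (Finset.Ico_disjoint_Ico_consecutive _ _ _),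
    Finset.Ico_union_Ico_eq_Ico]
  all_goals nlinarith

lemma dsum_zero {α : Type*} [AddCommMonoid α] (h : ℤ → α) (k : ℤ) :
    dsum 0 h k = h k := by
  unfold dsum
  have : Finset.Ico ((2 : ℤ) ^ 0 * k) (2 ^ 0 * (k + 1)) = {k} := by
    ext x; simp; omega
  rw [this, Finset.sum_singleton]

lemma tsum_dsum (m : ℕ) (h : ℤ → ℝ≥0∞) : ∑' k, dsum m h k = ∑' k, h k := by
  induction m with
  | zero => simp only [dsum_zero]
  | succ m ih =>
    simp only [dsum_succ]
    rw [tsum_parity (fun k => dsum m h k), ih]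

lemma dsum_int {f : ℝ → ℝ} (hf : LocallyIntegrable f) (m : ℕ) (j k : ℤ) :
    dsum m (fun ki => ∫ x in dyad (j + m) ki, f x) k = ∫ x in dyad j k, f x := by
  induction m generalizing j k with
  | zero => simp [dsum_zero]
  | succ m ih =>
    rw [dsum_succ, int_split hf j k, ← ih, ← ih]
    have : j + ((m + 1 : ℕ) : ℤ) = j + 1 + m := by push_cast; ring
    rw [this]

lemma tsum_level (q : ℝ → ℝ) (hq : Integrable q) (h0 : ∀ x, 0 ≤ q x) (j : ℤ) :
    ∑' k, ENNReal.ofReal (∫ x in dyad j k, q x) ≤ ENNReal.ofReal (∫ x, q x) := by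
  have : ∀ k, ENNReal.ofReal (∫ x in dyad j k, q x) = ∫⁻ x in dyad j k, ENNReal.ofReal (q x) :=
    fun k => ofReal_integral_eq_lintegral_ofReal hq.integrableOn
      (Filter.Eventually.of_forall h0)
  simp_rw [this]
  rw [← lintegral_iUnion (fun k => meas_dyad j k) (disj_dyad j),
    ofReal_integral_eq_lintegral_ofReal hq (Filter.Eventually.of_forall h0)]
  exact setLIntegral_le_lintegral _ _

lemma tele (G g : ℤ → ℤ → ℝ) (q : ℝ → ℝ) (hq : Integrable q) (h0 : ∀ x, 0 ≤ q x)
    (hG : ∀ j k, 0 ≤ G j k) (hg : ∀ j k, 0 ≤ g j k)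
    (hGF : ∀ j k, G j k ≤ ∫ x in dyad j k, q x)
    (step : ∀ j k, G (j + 1) (2 * k) + G (j + 1) (2 * k + 1) + g j k ≤ G j k) :
    ∑' p : ℤ × ℤ, ENNReal.ofReal (g p.1 p.2) ≤ ENNReal.ofReal (∫ x, q x) := by
  set T := ENNReal.ofReal (∫ x, q x)
  have lev : ∀ j, ∑' k, ENNReal.ofReal (G (j + 1) k) + ∑' k, ENNReal.ofReal (g j k)
      ≤ ∑' k, ENNReal.ofReal (G j k) := by
    intro j
    rw [← tsum_parity (fun k => ENNReal.ofReal (G (j + 1) k)), ← ENNReal.tsum_add]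
    refine ENNReal.tsum_le_tsum fun k => ?_
    rw [← ENNReal.ofReal_add (hG _ _) (hG _ _),
      ← ENNReal.ofReal_add (add_nonneg (hG _ _) (hG _ _)) (hg _ _)]
    exact ENNReal.ofReal_le_ofReal (step j k)
  have ind : ∀ (N : ℕ) (j : ℤ), ∑' k, ENNReal.ofReal (G (j + N) k) +
      ∑ i ∈ Finset.range N, ∑' k, ENNReal.ofReal (g (j + i) k) ≤ T := by
    intro N j
    induction N with
    | zero =>
      simp only [Nat.cast_zero, add_zero, Finset.range_zero, Finset.sum_empty]
      exact (ENNReal.tsum_le_tsum fun k => ENNReal.ofReal_le_ofReal (hGF j k)).trans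
        (tsum_level q hq h0 j)
    | succ N ih =>
      refine le_trans ?_ ih
      rw [Finset.sum_range_succ, add_comm (∑ i ∈ Finset.range N, _), ← add_assoc]
      have := lev (j + N)
      have e : j + ((N + 1 : ℕ) : ℤ) = j + N + 1 := by push_cast; ring
      rw [e]
      gcongr
  rw [ENNReal.tsum_prod (f := fun j k => ENNReal.ofReal (g j k))]
  rw [ENNReal.tsum_eq_iSup_sum]
  refine iSup_le fun s => ?_
  obtain ⟨j0, hj0⟩ := s.bddBelow
  obtain ⟨j1, hj1⟩ := s.bddAbove
  refine le_trans ?_ ((le_add_left le_rfl).trans (ind (j1 - j0 + 1).toNat j0))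
  have : s ⊆ (Finset.range (j1 - j0 + 1).toNat).image (fun i : ℕ => j0 + (i : ℤ)) := by
    intro x hx
    have a := hj0 hx
    have b := hj1 hx
    rw [Finset.mem_image]
    refine ⟨(x - j0).toNat, ?_, ?_⟩
    · rw [Finset.mem_range]; omega
    · omega
  refine (Finset.sum_le_sum_of_subset this).trans ?_
  rw [Finset.sum_image]
  intro a _ b _ hab
  simpa using hab

lemma li_prod {w φ : ℝ → ℝ} (hw : ∀ x, 0 < w x) (hwm : Measurable w) (hwl : LocallyIntegrable w)
    (hφ : Measurable φ) (hi : Integrable (fun x => (φ x) ^ 2 * w x)) :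
    LocallyIntegrable (fun x => φ x * w x) := by
  refine (hi.locallyIntegrable.add hwl).mono (hφ.mul hwm).aestronglyMeasurable ?_
  refine Filter.Eventually.of_forall fun x => ?_
  have h := hw x
  have h2 : 0 ≤ (φ x) ^ 2 * w x + w x := by positivity
  simp only [Pi.add_apply, Real.norm_eq_abs]
  rw [abs_of_nonneg h2, abs_mul, abs_of_pos h]
  nlinarith [mul_nonneg (sq_nonneg (|φ x| - 1)) h.le, sq_abs (φ x),
    mul_nonneg (abs_nonneg (φ x)) h.le, mul_nonneg (sq_nonneg (φ x)) h.le]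

lemma cs_prod {w φ : ℝ → ℝ} (hw : ∀ x, 0 < w x) (hwm : Measurable w) (hwl : LocallyIntegrable w)
    (hφ : Measurable φ) (hi : Integrable (fun x => (φ x) ^ 2 * w x)) (j k : ℤ) :
    (∫ x in dyad j k, φ x * w x) ^ 2 ≤
      (∫ x in dyad j k, (φ x) ^ 2 * w x) * ∫ x in dyad j k, w x := by
  refine cs_set _ _ _ _ hi.integrableOn (li_on (li_prod hw hwm hwl hφ hi) j k) (li_on hwl j k)
    ?_ (int_pos hwl hw j k)
  intro t x
  have : (φ x) ^ 2 * w x + 2 * t * (φ x * w x) + t ^ 2 * w x = (φ x + t) ^ 2 * w x := by ring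
  rw [this]
  exact mul_nonneg (sq_nonneg _) (hw x).le

lemma one_le_avg {w : ℝ → ℝ} (hw : ∀ x, 0 < w x) (hwl : LocallyIntegrable w)
    (hsl : LocallyIntegrable (fun x => (w x)⁻¹)) (j k : ℤ) :
    1 ≤ avg w j k * avg (fun x => (w x)⁻¹) j k := by
  have hd := dlen_pos j
  have h := cs_set (dyad j k) w (fun _ => 1) (fun x => (w x)⁻¹) (li_on hwl j k)
    (li_on (locallyIntegrable_const 1) j k) (li_on hsl j k) (by
      intro t x
      have h := hw x
      have : w x + 2 * t * 1 + t ^ 2 * (w x)⁻¹ = (w x + t) ^ 2 * (w x)⁻¹ := by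
        field_simp; ring
      rw [this]; positivity) (int_pos hsl (fun x => inv_pos.2 (hw x)) j k)
  have hv : ∫ x in dyad j k, (1 : ℝ) = dlen j := by
    rw [setIntegral_const, smul_eq_mul, mul_one, dyad, Real.volume_real_Ico]
    rw [max_eq_left] <;> nlinarith
  rw [hv, ← dlen_avg, ← dlen_avg] at h
  have h2 : dlen j ^ 2 * 1 ≤ dlen j ^ 2 * (avg w j k * avg (fun x => (w x)⁻¹) j k) := by
    nlinarith
  exact le_of_mul_le_mul_left h2 (by positivity)

/-- The Carleson-type summand. -/
def gphi (w φ : ℝ → ℝ) (j k : ℤ) : ℝ :=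
  dlen j * dOsc w j k ^ 2 * avg (fun x => |φ x| * w x) j k ^ 2 / avg w j k ^ 3

lemma gphi_nonneg {w φ : ℝ → ℝ} (hw : ∀ x, 0 < w x) (hwl : LocallyIntegrable w) (j k : ℤ) :
    0 ≤ gphi w φ j k := by
  have := avg_pos hwl hw j k
  have := dlen_pos j
  unfold gphi; positivity

lemma dOsc_sq {w : ℝ → ℝ} (hwl : LocallyIntegrable w) (j k : ℤ) :
    dOsc w j k ^ 2 = (avg w (j + 1) (2 * k + 1) - avg w (j + 1) (2 * k)) ^ 2 := by
  unfold dOsc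
  rw [avg_split hwl j k]
  set a := avg w (j + 1) (2 * k)
  set b := avg w (j + 1) (2 * k + 1)
  have e1 : a - (a + b) / 2 = -((b - a) / 2) := by ring
  have e2 : b - (a + b) / 2 = (b - a) / 2 := by ring
  rw [e1, e2, abs_neg]
  have : |(b - a) / 2| + |(b - a) / 2| = 2 * |(b - a) / 2| := by ring
  rw [this, mul_pow, sq_abs]; ring

lemma phi_sum {w φ : ℝ → ℝ} (hw : ∀ x, 0 < w x) (hwm : Measurable w) (hwl : LocallyIntegrable w)
    (hsl : LocallyIntegrable (fun x => (w x)⁻¹)) (Q : ℝ) (hQ1 : 1 ≤ Q)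
    (hQ : ∀ j k : ℤ, avg w j k * avg (fun x => (w x)⁻¹) j k ≤ Q)
    (hφ : Measurable φ) (hi : Integrable (fun x => (φ x) ^ 2 * w x)) :
    ∑' p : ℤ × ℤ, ENNReal.ofReal (gphi w φ p.1 p.2 / (384 * Q)) ≤
      ENNReal.ofReal (∫ x, (φ x) ^ 2 * w x) := by
  have hφa : Measurable (fun x => |φ x|) := hφ.abs
  have hia : Integrable (fun x => |φ x| ^ 2 * w x) := by simpa only [sq_abs] using hi
  have hu : ∀ j k, 0 < avg w j k := avg_pos hwl hw
  have hv : ∀ j k, 0 < avg (fun x => (w x)⁻¹) j k := avg_pos hsl (fun x => inv_pos.2 (hw x))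
  have h1 := one_le_avg hw hwl hsl
  have hl := li_prod hw hwm hwl hφa hia
  have hQ0 : 0 < Q := by linarith
  let X : ℤ → ℤ → ℝ := fun j k => avg w j k + bellB Q (avg w j k) (avg (fun x => (w x)⁻¹) j k) / (3 * Q)
  have hX1 : ∀ j k, avg w j k ≤ X j k := fun j k => by
    have := bellB_nonneg Q _ _ (hu j k) (hv j k) (h1 j k) (hQ j k)
    have : 0 ≤ bellB Q (avg w j k) (avg (fun x => (w x)⁻¹) j k) / (3 * Q) := by positivity
    simp only [X]; linarith
  have hX2 : ∀ j k, X j k ≤ 2 * avg w j k := fun j k => by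
    have := bellB_le Q _ _ (hu j k) (hv j k) (h1 j k) (hQ j k)
    have : bellB Q (avg w j k) (avg (fun x => (w x)⁻¹) j k) / (3 * Q) ≤ avg w j k := by
      rw [div_le_iff₀ (by positivity)]; linarith
    simp only [X]; linarith
  have hX0 : ∀ j k, 0 < X j k := fun j k => (hu j k).trans_le (hX1 j k)
  refine tele (fun j k => (∫ x in dyad j k, (φ x) ^ 2 * w x) -
      dlen j * (avg (fun x => |φ x| * w x) j k ^ 2 / X j k))
      (fun j k => gphi w φ j k / (384 * Q)) _ hi
      (fun x => mul_nonneg (sq_nonneg _) (hw x).le) ?_ ?_ ?_ ?_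
  · intro j k
    have c := cs_prod hw hwm hwl hφa hia j k
    simp only [sq_abs] at c
    rw [← dlen_avg (fun x => |φ x| * w x), ← dlen_avg w] at c
    have hd := dlen_pos j
    have h3 : dlen j * (avg (fun x => |φ x| * w x) j k ^ 2 / X j k) ≤
        dlen j * (avg (fun x => |φ x| * w x) j k ^ 2 / avg w j k) := by
      have := hX1 j k
      have := hu j k
      gcongr
    have h4 : dlen j * (avg (fun x => |φ x| * w x) j k ^ 2 / avg w j k) ≤
        ∫ x in dyad j k, (φ x) ^ 2 * w x := by
      rw [← mul_div_assoc, div_le_iff₀ (hu j k)]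
      refine le_of_mul_le_mul_left ?_ hd
      nlinarith
    linarith
  · intro j k
    exact div_nonneg (gphi_nonneg hw hwl j k) (by positivity)
  · intro j k
    have := dlen_pos j
    have := hX0 j k
    have : 0 ≤ dlen j * (avg (fun x => |φ x| * w x) j k ^ 2 / X j k) := by positivity
    linarith
  · intro j k
    have B := bellB_step Q _ _ _ _ _ _ (hu (j + 1) (2 * k)) (hu (j + 1) (2 * k + 1))
      (hv (j + 1) (2 * k)) (hv (j + 1) (2 * k + 1)) (avg_split hwl j k) (avg_split hsl j k) (hQ j k)
    have hα : (X (j + 1) (2 * k) + X (j + 1) (2 * k + 1)) / 2 +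
        dOsc w j k ^ 2 / (96 * Q * avg w j k) ≤ X j k := by
      rw [dOsc_sq hwl j k]
      have B2 := div_le_div_of_nonneg_right B (by positivity : 0 ≤ 3 * Q)
      have e : (avg w (j + 1) (2 * k + 1) - avg w (j + 1) (2 * k)) ^ 2 / (96 * Q * avg w j k) =
          (avg w (j + 1) (2 * k + 1) - avg w (j + 1) (2 * k)) ^ 2 / (32 * avg w j k) / (3 * Q) := by
        rw [div_div]; congr 1; ring
      rw [e]
      rw [add_div] at B2
      have s := avg_split hwl j k
      simp only [X]
      have e3 : ∀ a b : ℝ, (a + b) / 2 / (3 * Q) = (a / (3 * Q) + b / (3 * Q)) / 2 := by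
        intro a b; ring
      rw [e3] at B2
      linarith
    have E := embed_step _ _ _ _ _ _ _ _ (hX0 (j + 1) (2 * k)) (hX0 (j + 1) (2 * k + 1))
      (avg_split hl j k) (by have := hu j k; positivity) hα (hu j k) (hX2 j k)
    have S := int_split hi.locallyIntegrable j k
    have hd := dlen_pos (j + 1)
    have hg : gphi w φ j k / (384 * Q) = dlen j * (dOsc w j k ^ 2 / (96 * Q * avg w j k) *
        avg (fun x => |φ x| * w x) j k ^ 2 / (4 * avg w j k ^ 2)) := by
      unfold gphi
      have := hu j k
      field_simp; ring
    rw [hg, S, dlen_succ j]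
    have E2 := mul_le_mul_of_nonneg_left E (by positivity : 0 ≤ 2 * dlen (j + 1))
    nlinarith

lemma haar_int {h p : ℝ → ℝ} {j k : ℤ} (hp : LocallyIntegrable p)
    (hz : ∀ x ∉ dyad j k, h x = 0)
    (h1 : ∀ x ∈ dyad (j + 1) (2 * k), ∀ y ∈ dyad (j + 1) (2 * k), h x = h y)
    (h2 : ∀ x ∈ dyad (j + 1) (2 * k + 1), ∀ y ∈ dyad (j + 1) (2 * k + 1), h x = h y) :
    ∫ x, h x * p x = h (((2 * k : ℤ) : ℝ) * dlen (j + 1)) * (∫ x in dyad (j + 1) (2 * k), p x) +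
      h (((2 * k + 1 : ℤ) : ℝ) * dlen (j + 1)) * ∫ x in dyad (j + 1) (2 * k + 1), p x := by
  have hm : ∀ k : ℤ, (k : ℝ) * dlen (j + 1) ∈ dyad (j + 1) k := by
    intro k
    have := dlen_pos (j + 1)
    unfold dyad
    exact ⟨le_rfl, by nlinarith⟩
  have c1 : EqOn (fun x => h x * p x) (fun x => h (((2 * k : ℤ) : ℝ) * dlen (j + 1)) * p x)
      (dyad (j + 1) (2 * k)) := fun x hx => by
    simp only; rw [h1 x hx _ (hm _)]
  have c2 : EqOn (fun x => h x * p x) (fun x => h (((2 * k + 1 : ℤ) : ℝ) * dlen (j + 1)) * p x)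
      (dyad (j + 1) (2 * k + 1)) := fun x hx => by
    simp only; rw [h2 x hx _ (hm _)]
  have i1 : IntegrableOn (fun x => h x * p x) (dyad (j + 1) (2 * k)) :=
    (integrableOn_congr_fun c1 (meas_dyad _ _)).2 ((li_on hp _ _).const_mul _)
  have i2 : IntegrableOn (fun x => h x * p x) (dyad (j + 1) (2 * k + 1)) :=
    (integrableOn_congr_fun c2 (meas_dyad _ _)).2 ((li_on hp _ _).const_mul _)
  rw [← setIntegral_eq_integral_of_forall_compl_eq_zero (s := dyad j k)
    (fun x hx => by rw [hz x hx, zero_mul]), dyad_split j k,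
    setIntegral_union (disj_halves j k) (meas_dyad _ _) i1 i2,
    setIntegral_congr_fun (meas_dyad _ _) c1, setIntegral_congr_fun (meas_dyad _ _) c2,
    integral_const_mul, integral_const_mul]

lemma psi_sum {v ψ : ℝ → ℝ} (hv : ∀ x, 0 < v x) (hvm : Measurable v) (hvl : LocallyIntegrable v)
    (hS : ℤ → ℤ → ℝ → ℝ)
    (hz : ∀ j k : ℤ, ∀ x ∉ dyad j k, hS j k x = 0)
    (h1 : ∀ j k : ℤ, ∀ x ∈ dyad (j + 1) (2 * k), ∀ y ∈ dyad (j + 1) (2 * k),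
          hS j k x = hS j k y)
    (h2 : ∀ j k : ℤ, ∀ x ∈ dyad (j + 1) (2 * k + 1), ∀ y ∈ dyad (j + 1) (2 * k + 1),
          hS j k x = hS j k y)
    (h3 : ∀ j k : ℤ, (∫ x, hS j k x * v x) = 0)
    (h4 : ∀ j k : ℤ, (∫ x, (hS j k x) ^ 2 * v x) = 1)
    (hψ : Measurable ψ) (hi : Integrable (fun x => (ψ x) ^ 2 * v x)) :
    ∑' p : ℤ × ℤ, ENNReal.ofReal ((∫ x, ψ x * hS p.1 p.2 x * v x) ^ 2) ≤
      ENNReal.ofReal (∫ x, (ψ x) ^ 2 * v x) := by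
  have hl := li_prod hv hvm hvl hψ hi
  have hp := int_pos hvl hv
  refine tele (fun j k => (∫ x in dyad j k, (ψ x) ^ 2 * v x) -
      (∫ x in dyad j k, ψ x * v x) ^ 2 / ∫ x in dyad j k, v x)
      (fun j k => (∫ x, ψ x * hS j k x * v x) ^ 2) _ hi
      (fun x => mul_nonneg (sq_nonneg _) (hv x).le) ?_ ?_ ?_ ?_
  · intro j k
    have c := cs_prod hv hvm hvl hψ hi j k
    rw [← div_le_iff₀ (hp j k)] at c
    linarith
  · intro j k; positivity
  · intro j k
    have := hp j k
    have : 0 ≤ (∫ x in dyad j k, ψ x * v x) ^ 2 / ∫ x in dyad j k, v x := by positivity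
    linarith
  · intro j k
    have e0 := haar_int hvl (hz j k) (h1 j k) (h2 j k)
    have e1 := haar_int (h := fun x => hS j k x ^ 2) hvl (fun x hx => by simp [hz j k x hx])
      (fun x hx y hy => by rw [h1 j k x hx y hy])
      (fun x hx y hy => by rw [h2 j k x hx y hy])
    have e2 := haar_int hl (hz j k) (h1 j k) (h2 j k)
    rw [h3] at e0
    rw [h4] at e1
    have e3 : ∫ x, ψ x * hS j k x * v x = ∫ x, hS j k x * (ψ x * v x) := by
      congr 1; ext x; ring
    have H := haar_step _ _ _ _ (∫ x in dyad (j + 1) (2 * k), ψ x * v x)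
      (∫ x in dyad (j + 1) (2 * k + 1), ψ x * v x) (hp (j + 1) (2 * k)) (hp (j + 1) (2 * k + 1))
      e0.symm e1.symm
    rw [← e2, ← e3, ← int_split hl j k, ← int_split hvl j k] at H
    have S := int_split hi.locallyIntegrable j k
    linarith

lemma tsum_gen (g : ℤ → ℤ → ℝ) (hg : ∀ j k, 0 ≤ g j k) (m : ℕ) :
    ∑' L : ℤ × ℤ, ENNReal.ofReal (dsum m (g (L.1 + m)) L.2) =
      ∑' p : ℤ × ℤ, ENNReal.ofReal (g p.1 p.2) := by
  have e : ∀ j k, ENNReal.ofReal (dsum m (g j) k) = dsum m (fun i => ENNReal.ofReal (g j i)) k := by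
    intro j k
    unfold dsum
    rw [ENNReal.ofReal_sum_of_nonneg fun i _ => hg j i]
  simp_rw [e]
  rw [ENNReal.tsum_prod (f := fun j k => dsum m (fun i => ENNReal.ofReal (g (j + m) i)) k),
    ENNReal.tsum_prod (f := fun j k => ENNReal.ofReal (g j k))]
  simp_rw [tsum_dsum]
  exact (Equiv.addRight (m : ℤ)).tsum_eq (fun j => ∑' k, ENNReal.ofReal (g j k))

lemma dsum_avg {f : ℝ → ℝ} (hf : LocallyIntegrable f) (m : ℕ) (j k : ℤ) :
    dsum m (fun i => avg f (j + m) i * dlen (j + m) / dlen j) k = avg f j k := by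
  have := dsum_int hf m j k
  unfold dsum at *
  rw [← Finset.sum_div, avg, ← this, div_eq_inv_mul]
  congr 1
  refine Finset.sum_congr rfl fun i _ => ?_
  simp only
  rw [← dlen_avg, mul_comm]

lemma RL_nonneg {w φ : ℝ → ℝ} (hw : ∀ x, 0 < w x) (hwl : LocallyIntegrable w)
    (m : ℕ) (j k : ℤ) : 0 ≤ RL w m φ j k := by
  unfold RL
  refine Finset.sum_nonneg fun i _ => ?_
  have := avg_pos hwl hw (j + m) i
  have h2 := dlen_pos (j + m)
  have h3 : 0 ≤ avg (fun x => |φ x| * w x) (j + m) i :=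
    mul_nonneg (inv_pos.2 h2).le (integral_nonneg fun x => mul_nonneg (abs_nonneg _) (hw x).le)
  have h4 : 0 ≤ dOsc w (j + m) i := by unfold dOsc; positivity
  positivity

lemma RL_sq {w φ : ℝ → ℝ} (hw : ∀ x, 0 < w x) (hwl : LocallyIntegrable w)
    (m : ℕ) (j k : ℤ) : RL w m φ j k ^ 2 ≤ dsum m (gphi w φ (j + m)) k * avg w j k := by
  rw [← dsum_avg hwl m j k]
  unfold RL dsum
  have h3 := dlen_pos j
  have h2 := dlen_pos (j + m)
  refine Finset.sum_sq_le_sum_mul_sum_of_sq_le_mul _ (fun i _ => gphi_nonneg hw hwl _ _) ?_ ?_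
  · intro i _
    have := avg_pos hwl hw (j + m) i
    positivity
  · intro i _
    have := avg_pos hwl hw (j + m) i
    unfold gphi
    apply le_of_eq
    simp only [mul_pow, div_pow, Real.sq_sqrt h3.le]
    field_simp

lemma SL_nonneg (v : ℝ → ℝ) (hV : ℤ → ℤ → ℝ → ℝ) (n : ℕ) (ψ : ℝ → ℝ) (j k : ℤ) :
    0 ≤ SL v hV n ψ j k := by
  unfold SL
  exact Finset.sum_nonneg fun i _ => by positivity

lemma SL_sq {v : ℝ → ℝ} (hv : ∀ x, 0 < v x) (hvl : LocallyIntegrable v)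
    (hV : ℤ → ℤ → ℝ → ℝ) (n : ℕ) (ψ : ℝ → ℝ) (j k : ℤ) :
    SL v hV n ψ j k ^ 2 ≤ dsum n (fun i => (∫ x, ψ x * hV (j + n) i x * v x) ^ 2) k * avg v j k := by
  rw [← dsum_avg hvl n j k]
  unfold SL dsum
  have h3 := dlen_pos j
  have h2 := dlen_pos (j + n)
  refine Finset.sum_sq_le_sum_mul_sum_of_sq_le_mul _ (fun i _ => by positivity) ?_ ?_
  · intro i _
    have := avg_pos hvl hv (j + n) i
    positivity
  · intro i _
    have := avg_pos hvl hv (j + n) i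
    rw [mul_pow, mul_pow, Real.sq_sqrt this.le, Real.sq_sqrt (by positivity), sq_abs]
    apply le_of_eq
    ring

lemma sum_le_of_tsum (a : ℤ × ℤ → ℝ) (ha : ∀ p, 0 ≤ a p) (T : ℝ) (hT : 0 ≤ T)
    (h : ∑' p, ENNReal.ofReal (a p) ≤ ENNReal.ofReal T) (s : Finset (ℤ × ℤ)) :
    ∑ p ∈ s, a p ≤ T := by
  have h2 := (ENNReal.sum_le_tsum s).trans h
  rw [← ENNReal.ofReal_sum_of_nonneg fun i _ => ha i] at h2
  exact (ENNReal.ofReal_le_ofReal_iff hT).1 h2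

/-- `∑_L R_L(φw) S_L(ψσ) ≤ C (m+n+1)³ [w]_{A₂} ‖φ‖_{L²(w)} ‖ψ‖_{L²(σ)}`. -/
theorem sum_RL_SL_bound :
    ∃ C : ℝ, 0 < C ∧
      ∀ (m n : ℕ) (w : ℝ → ℝ), (∀ x, 0 < w x) → Measurable w →
        LocallyIntegrable w → LocallyIntegrable (fun x => (w x)⁻¹) →
      ∀ Q : ℝ, 1 ≤ Q →
        (∀ j k : ℤ, avg w j k * avg (fun x => (w x)⁻¹) j k ≤ Q) →
      ∀ hS : ℤ → ℤ → ℝ → ℝ, (∀ j k : ℤ, Measurable (hS j k)) →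
        (∀ j k : ℤ, ∀ x ∉ dyad j k, hS j k x = 0) →
        (∀ j k : ℤ, ∀ x ∈ dyad (j + 1) (2 * k), ∀ y ∈ dyad (j + 1) (2 * k),
          hS j k x = hS j k y) →
        (∀ j k : ℤ, ∀ x ∈ dyad (j + 1) (2 * k + 1), ∀ y ∈ dyad (j + 1) (2 * k + 1),
          hS j k x = hS j k y) →
        (∀ j k : ℤ, (∫ x, hS j k x * (w x)⁻¹) = 0) →
        (∀ j k : ℤ, (∫ x, (hS j k x) ^ 2 * (w x)⁻¹) = 1) →
      ∀ φ ψ : ℝ → ℝ, Measurable φ → Measurable ψ →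
        Integrable (fun x => (φ x) ^ 2 * w x) →
        Integrable (fun x => (ψ x) ^ 2 * (w x)⁻¹) →
        (∑' L : ℤ × ℤ,
            ENNReal.ofReal (RL w m φ L.1 L.2 *
              SL (fun x => (w x)⁻¹) hS n ψ L.1 L.2))
          ≤ ENNReal.ofReal (C * ((m : ℝ) + n + 1) ^ 3 * Q *
              Real.sqrt (∫ x, (φ x) ^ 2 * w x) *
              Real.sqrt (∫ x, (ψ x) ^ 2 * (w x)⁻¹)) := by
  refine ⟨20, by norm_num, ?_⟩
  intro m n w hw hwm hwl hsl Q hQ1 hQ hS _ hz h1 h2 h3 h4 φ ψ hφ hψ hiφ hiψ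
  have hσ : ∀ x, 0 < (w x)⁻¹ := fun x => inv_pos.2 (hw x)
  have hQ0 : 0 < Q := by linarith
  set Φ := ∫ x, (φ x) ^ 2 * w x with hΦ
  set Ψ := ∫ x, (ψ x) ^ 2 * (w x)⁻¹ with hΨ
  have hΦ0 : 0 ≤ Φ := integral_nonneg fun x => mul_nonneg (sq_nonneg _) (hw x).le
  have hΨ0 : 0 ≤ Ψ := integral_nonneg fun x => mul_nonneg (sq_nonneg _) (hσ x).le
  have A := phi_sum hw hwm hwl hsl Q hQ1 hQ hφ hiφ
  have B := psi_sum hσ hwm.inv hsl hS hz h1 h2 h3 h4 hψ hiψ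
  have ga : ∀ j k, 0 ≤ gphi w φ j k / (384 * Q) := fun j k =>
    div_nonneg (gphi_nonneg hw hwl j k) (by positivity)
  have gb : ∀ j k : ℤ, 0 ≤ (∫ x, ψ x * hS j k x * (w x)⁻¹) ^ 2 := fun j k => sq_nonneg _
  rw [← tsum_gen (fun j k => gphi w φ j k / (384 * Q)) ga m] at A
  rw [← tsum_gen (fun j k => (∫ x, ψ x * hS j k x * (w x)⁻¹) ^ 2) gb n] at B
  set a : ℤ × ℤ → ℝ := fun L => dsum m (fun k => gphi w φ (L.1 + m) k / (384 * Q)) L.2 with ha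
  set b : ℤ × ℤ → ℝ := fun L =>
    dsum n (fun k => (∫ x, ψ x * hS (L.1 + n) k x * (w x)⁻¹) ^ 2) L.2 with hb
  have a0 : ∀ L, 0 ≤ a L := fun L => Finset.sum_nonneg fun i _ => ga _ _
  have b0 : ∀ L, 0 ≤ b L := fun L => Finset.sum_nonneg fun i _ => gb _ _
  have term : ∀ L : ℤ × ℤ, RL w m φ L.1 L.2 * SL (fun x => (w x)⁻¹) hS n ψ L.1 L.2 ≤
      20 * Q * (√(a L) * √(b L)) := by
    intro L
    have r0 := RL_nonneg (φ := φ) hw hwl m L.1 L.2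
    have s0 := SL_nonneg (fun x => (w x)⁻¹) hS n ψ L.1 L.2
    have r := RL_sq (φ := φ) hw hwl m L.1 L.2
    have s := SL_sq hσ hsl hS n ψ L.1 L.2
    have e : dsum m (gphi w φ (L.1 + m)) L.2 = 384 * Q * a L := by
      rw [ha]; simp only [dsum]
      rw [Finset.mul_sum]
      refine Finset.sum_congr rfl fun i _ => ?_
      field_simp
    rw [e] at r
    have aL := a0 L
    have bL := b0 L
    have hu := avg_pos hwl hw L.1 L.2
    have hv := avg_pos hsl hσ L.1 L.2
    refine (abs_le_of_sq_le_sq' ?_ (by positivity)).2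
    rw [mul_pow, mul_pow, mul_pow (√(a L)), Real.sq_sqrt aL, Real.sq_sqrt bL]
    have h5 := mul_le_mul r s (sq_nonneg _) (by positivity)
    refine h5.trans ?_
    have h6 : 384 * Q * a L * avg w L.1 L.2 * (b L * avg (fun x => (w x)⁻¹) L.1 L.2) =
        384 * Q * (a L * b L) * (avg w L.1 L.2 * avg (fun x => (w x)⁻¹) L.1 L.2) := by ring
    refine h6.le.trans ((mul_le_mul_of_nonneg_left (hQ L.1 L.2) (by positivity)).trans ?_)
    have : 0 ≤ Q ^ 2 * (a L * b L) := by positivity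
    nlinarith
  rw [ENNReal.tsum_eq_iSup_sum]
  refine iSup_le fun s => ?_
  rw [← ENNReal.ofReal_sum_of_nonneg fun L _ =>
    mul_nonneg (RL_nonneg hw hwl m L.1 L.2) (SL_nonneg _ hS n ψ L.1 L.2)]
  refine ENNReal.ofReal_le_ofReal ?_
  calc _ ≤ ∑ L ∈ s, 20 * Q * (√(a L) * √(b L)) := Finset.sum_le_sum fun L _ => term L
    _ = 20 * Q * ∑ L ∈ s, √(a L) * √(b L) := by rw [Finset.mul_sum]
    _ ≤ 20 * Q * (√(∑ L ∈ s, a L) * √(∑ L ∈ s, b L)) := by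
        gcongr
        exact Real.sum_sqrt_mul_sqrt_le s a0 b0
    _ ≤ 20 * Q * (√Φ * √Ψ) := by
        have := sum_le_of_tsum a a0 Φ hΦ0 A s
        have := sum_le_of_tsum b b0 Ψ hΨ0 B s
        gcongr
    _ ≤ 20 * ((m : ℝ) + n + 1) ^ 3 * Q * √Φ * √Ψ := by
        have h7 : (1 : ℝ) ≤ ((m : ℝ) + n + 1) ^ 3 := by
          apply one_le_pow₀
          have : (0 : ℝ) ≤ m := Nat.cast_nonneg m
          have : (0 : ℝ) ≤ n := Nat.cast_nonneg n
          linarith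
        have h8 : 0 ≤ 20 * Q * (√Φ * √Ψ) := by positivity
        nlinarith [mul_le_mul_of_nonneg_right h7 h8]
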